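/- Let H₀ be a Hermitian operator on (ℂ²)^{⊗n} of the form H₀ = −Σ_{g∈G} g for an independent generating set G of a maximal (rank-n) stabilizer group, with unique ground state |S⟩ (a pure stabilizer state) and spectral gap Δ > 0 above the ground energy. Let V be Hermitian and suppose (I − |S⟩⟨S|) V |S⟩ ≠ 0. Then there exists λ₀ > 0 such that for all real λ with 0 < |λ| < λ₀: (1) H(λ) := H₀ + λV has a unique ground state |ψ(λ)⟩, and |ψ(λ)⟩⟨ψ(λ)| is not equal to |φ⟩⟨φ| for any pure stabilizer state φ; (2) δ_STAB(H(λ)) > 0. -/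

import Mathlib

open Matrix BigOperators

noncomputable section

/-- Operators on the `n`-qubit Hilbert space `(ℂ²)^{⊗n}`. -/
abbrev QOp (n : ℕ) := Matrix (Fin n → Fin 2) (Fin n → Fin 2) ℂ

/-- Vectors in the `n`-qubit Hilbert space. -/
abbrev QVec (n : ℕ) := (Fin n → Fin 2) → ℂ

/-- The Pauli X matrix. -/
def PX : Matrix (Fin 2) (Fin 2) ℂ := !![0, 1; 1, 0]
/-- The Pauli Y matrix. -/
def PY : Matrix (Fin 2) (Fin 2) ℂ := !![0, -Complex.I; Complex.I, 0]
/-- The Pauli Z matrix. -/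
def PZ : Matrix (Fin 2) (Fin 2) ℂ := !![1, 0; 0, -1]

/-- Tensor product of single-qubit operators, one per site. -/
def tens {n : ℕ} (P : Fin n → Matrix (Fin 2) (Fin 2) ℂ) : QOp n :=
  Matrix.of fun v w => ∏ i, P i (v i) (w i)

/-- An element of the `n`-qubit Pauli group: a phase `±1, ±i` times a tensor
product of `I, X, Y, Z`. -/
def IsPauli {n : ℕ} (A : QOp n) : Prop :=
  ∃ c : ℂ, (c = 1 ∨ c = -1 ∨ c = Complex.I ∨ c = -Complex.I) ∧
    ∃ P : Fin n → Matrix (Fin 2) (Fin 2) ℂ,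
      (∀ i, P i = 1 ∨ P i = PX ∨ P i = PY ∨ P i = PZ) ∧ A = c • tens P

/-- A stabilizer group: an abelian subgroup of the `n`-qubit Pauli group not
containing `-I` (presented as a set of matrices closed under multiplication). -/
structure IsStabGroup {n : ℕ} (S : Set (QOp n)) : Prop where
  pauli : ∀ A ∈ S, IsPauli A
  one_mem : (1 : QOp n) ∈ S
  mul_mem : ∀ A ∈ S, ∀ B ∈ S, A * B ∈ S
  comm : ∀ A ∈ S, ∀ B ∈ S, A * B = B * A
  neg_one_not_mem : -(1 : QOp n) ∉ S

/-- A maximal (rank-`n`) stabilizer group has `2^n` elements. -/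
def IsMaxStabGroup {n : ℕ} (S : Set (QOp n)) : Prop :=
  IsStabGroup S ∧ Nat.card S = 2 ^ n

/-- A pure stabilizer state: a unit vector fixed by every element of some
maximal stabilizer group. -/
def IsPureStab {n : ℕ} (ψ : QVec n) : Prop :=
  star ψ ⬝ᵥ ψ = 1 ∧
    ∃ S : Set (QOp n), IsMaxStabGroup S ∧ ∀ A ∈ S, A.mulVec ψ = ψ

/-- The projector `|ψ⟩⟨ψ|`. -/
def proj {n : ℕ} (ψ : QVec n) : QOp n := Matrix.vecMulVec ψ (star ψ)

/-- The stabilizer polytope `STAB_n`: the convex hull of the projectors onto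
pure stabilizer states. -/
def StabPolytope (n : ℕ) : Set (QOp n) :=
  convexHull ℝ {M : QOp n | ∃ ψ : QVec n, IsPureStab ψ ∧ M = proj ψ}

/-- The stabilizer ground-state energy `E_STAB(H) = min_{ρ ∈ STAB_n} tr(Hρ)`. -/
def stabEnergy {n : ℕ} (H : QOp n) : ℝ :=
  sInf ((fun ρ => ((H * ρ).trace).re) '' StabPolytope n)

/-- The minimal eigenvalue `E_gs(H)` of a matrix. -/
def minEig {m : Type} [Fintype m] [DecidableEq m] (H : Matrix m m ℂ) : ℝ :=
  sInf {E : ℝ | ∃ ψ : m → ℂ, ψ ≠ 0 ∧ H.mulVec ψ = (E : ℂ) • ψ}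

/-- The stabilizer gap `δ_STAB(H) = E_STAB(H) − E_gs(H)`. -/
def stabGap {n : ℕ} (H : QOp n) : ℝ := stabEnergy H - minEig H

section Spectral

open scoped ComplexOrder

variable {m : Type} [Fintype m]

/-- The real part of the expectation value `⟨w|A|w⟩`. -/
def expect (A : Matrix m m ℂ) (w : m → ℂ) : ℝ := (star w ⬝ᵥ A *ᵥ w).re

lemma star_dotProduct_self_im (w : m → ℂ) : (star w ⬝ᵥ w).im = 0 :=
  (Complex.nonneg_iff.1 (dotProduct_star_self_nonneg w)).2.symm

lemma star_dotProduct_self_re_nonneg (w : m → ℂ) : 0 ≤ (star w ⬝ᵥ w).re :=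
  (Complex.nonneg_iff.1 (dotProduct_star_self_nonneg w)).1

lemma star_dotProduct_self_re_pos {w : m → ℂ} (hw : w ≠ 0) : 0 < (star w ⬝ᵥ w).re := by
  refine lt_of_le_of_ne (star_dotProduct_self_re_nonneg w) fun h => hw ?_
  rw [← dotProduct_star_self_eq_zero]
  exact Complex.ext h.symm (star_dotProduct_self_im w)

lemma ne_zero_of_unit {w : m → ℂ} (hw : star w ⬝ᵥ w = 1) : w ≠ 0 := by
  rintro rfl
  simp at hw

lemma expect_add (A B : Matrix m m ℂ) (w : m → ℂ) :
    expect (A + B) w = expect A w + expect B w := by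
  simp [expect, add_mulVec, dotProduct_add]

lemma expect_smul (r : ℝ) (A : Matrix m m ℂ) (w : m → ℂ) :
    expect (r • A) w = r * expect A w := by
  simp [expect, smul_mulVec, dotProduct_smul]

lemma expect_eq_of_eigen {A : Matrix m m ℂ} {w : m → ℂ} {E : ℝ} (h : A *ᵥ w = (E : ℂ) • w) :
    expect A w = E * (star w ⬝ᵥ w).re := by
  simp [expect, h, dotProduct_smul]

/-- Rescaling a nonzero vector to a unit vector. -/
lemma exists_unit_smul {w : m → ℂ} (hw : w ≠ 0) :
    ∃ c : ℂ, star (c • w) ⬝ᵥ (c • w) = 1 := by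
  have h := star_dotProduct_self_re_pos hw
  have h' : star w ⬝ᵥ w = ((star w ⬝ᵥ w).re : ℂ) := Complex.ext rfl (star_dotProduct_self_im w)
  set r := (star w ⬝ᵥ w).re
  refine ⟨((Real.sqrt r)⁻¹ : ℝ), ?_⟩
  rw [star_smul, smul_dotProduct, dotProduct_smul, h']
  simp only [Complex.star_def, Complex.conj_ofReal, smul_eq_mul]
  rw [← Complex.ofReal_mul, ← Complex.ofReal_mul, ← Complex.ofReal_one]
  congr 1
  have := Real.sqrt_pos.2 h
  field_simp
  exact (Real.sq_sqrt h.le).symm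

lemma sum_norm_sq_eq (w : m → ℂ) : ∑ i, ‖w i‖ ^ 2 = (star w ⬝ᵥ w).re := by
  simp only [dotProduct, Complex.re_sum]
  refine Finset.sum_congr rfl fun i _ => ?_
  simp [Complex.sq_norm, Complex.normSq_apply]

/-- A crude bound on expectation values by the sum of the norms of the entries. -/
lemma abs_expect_le (A : Matrix m m ℂ) (w : m → ℂ) :
    |expect A w| ≤ (∑ i, ∑ j, ‖A i j‖) * (star w ⬝ᵥ w).re := by
  have hle : ∀ i, ‖w i‖ ^ 2 ≤ (star w ⬝ᵥ w).re := fun i => by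
    rw [← sum_norm_sq_eq]
    exact Finset.single_le_sum (f := fun i => ‖w i‖ ^ 2) (fun _ _ => by positivity)
      (Finset.mem_univ i)
  refine (Complex.abs_re_le_norm _).trans ?_
  simp only [dotProduct, mulVec, Finset.mul_sum] at hle ⊢
  rw [Finset.sum_mul]
  refine (norm_sum_le _ _).trans (Finset.sum_le_sum fun i _ => ?_)
  rw [Finset.sum_mul]
  refine (norm_sum_le _ _).trans (Finset.sum_le_sum fun j _ => ?_)
  rw [norm_mul, norm_mul, Pi.star_apply, norm_star]
  have hi := hle i
  have hj := hle j
  have : ‖w i‖ * ‖w j‖ ≤ (∑ x, star w x * w x).re := by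
    nlinarith [sq_nonneg (‖w i‖ - ‖w j‖)]
  nlinarith [norm_nonneg (A i j)]

variable [DecidableEq m]

/-- A Hermitian matrix all of whose eigenvalues are at least `c` dominates `c • 1`. -/
lemma posSemidef_sub_of_le {A : Matrix m m ℂ} (hA : A.IsHermitian) {c : ℝ}
    (h : ∀ (E : ℝ) (ψ : m → ℂ), ψ ≠ 0 → A *ᵥ ψ = (E : ℂ) • ψ → c ≤ E) :
    (A - (c : ℂ) • (1 : Matrix m m ℂ)).PosSemidef := by
  have hB : (A - (c : ℂ) • (1 : Matrix m m ℂ)).IsHermitian := by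
    refine hA.sub ?_
    simp [IsHermitian, conjTranspose_smul]
  rw [hB.posSemidef_iff_eigenvalues_nonneg]
  intro i
  have h0 : (⇑(hB.eigenvectorBasis i) : m → ℂ) ≠ 0 := fun h0 =>
    hB.eigenvectorBasis.orthonormal.ne_zero i (by ext j; exact congrFun h0 j)
  have h1 := hB.mulVec_eigenvectorBasis i
  have h2 := h (hB.eigenvalues i + c) _ h0 (by
    rw [sub_mulVec, smul_mulVec, one_mulVec, sub_eq_iff_eq_add] at h1
    rw [h1]
    push_cast
    rw [add_smul]
    rfl)
  simpa using h2

/-- The infimum defining `minEig` is attained. -/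
lemma isLeast_minEig [Nonempty m] {A : Matrix m m ℂ} (hA : A.IsHermitian) :
    IsLeast {E : ℝ | ∃ ψ : m → ℂ, ψ ≠ 0 ∧ A.mulVec ψ = (E : ℂ) • ψ} (minEig A) := by
  have hne : {E : ℝ | ∃ ψ : m → ℂ, ψ ≠ 0 ∧ A.mulVec ψ = (E : ℂ) • ψ}.Nonempty := by
    obtain ⟨i⟩ := ‹Nonempty m›
    refine ⟨hA.eigenvalues i, ⇑(hA.eigenvectorBasis i), fun h0 =>
      hA.eigenvectorBasis.orthonormal.ne_zero i (by ext j; exact congrFun h0 j), ?_⟩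
    rw [hA.mulVec_eigenvectorBasis i]
    rfl
  have hfin : {E : ℝ | ∃ ψ : m → ℂ, ψ ≠ 0 ∧ A.mulVec ψ = (E : ℂ) • ψ}.Finite := by
    refine (finite_real_spectrum (A := A)).subset ?_
    rintro E ⟨ψ, hψ, h⟩
    rw [spectrum.mem_iff]
    intro hu
    refine hψ (mulVec_injective_of_isUnit hu ?_)
    rw [sub_mulVec, h, mulVec_zero, Algebra.algebraMap_eq_smul_one, smul_mulVec, one_mulVec]
    exact sub_self _
  exact ⟨hne.csInf_mem hfin, fun E hE => csInf_le hfin.bddBelow hE⟩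

lemma posSemidef_sub_minEig [Nonempty m] {A : Matrix m m ℂ} (hA : A.IsHermitian) :
    (A - (minEig A : ℂ) • (1 : Matrix m m ℂ)).PosSemidef :=
  posSemidef_sub_of_le hA fun _ ψ hψ h => (isLeast_minEig hA).2 ⟨ψ, hψ, h⟩

lemma expect_sub_smul_one (A : Matrix m m ℂ) (c : ℝ) (w : m → ℂ) :
    expect (A - (c : ℂ) • (1 : Matrix m m ℂ)) w = expect A w - c * (star w ⬝ᵥ w).re := by
  simp [expect, sub_mulVec, smul_mulVec, dotProduct_sub, dotProduct_smul]

lemma le_expect {A : Matrix m m ℂ} {c : ℝ}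
    (h : (A - (c : ℂ) • (1 : Matrix m m ℂ)).PosSemidef) (w : m → ℂ) :
    c * (star w ⬝ᵥ w).re ≤ expect A w := by
  have := (Complex.nonneg_iff.1 (h.dotProduct_mulVec_nonneg w)).1
  change 0 ≤ expect _ w at this
  rw [expect_sub_smul_one] at this
  linarith

/-- A vector attaining the variational lower bound is an eigenvector. -/
lemma eigen_of_expect_eq {A : Matrix m m ℂ} {c : ℝ}
    (h : (A - (c : ℂ) • (1 : Matrix m m ℂ)).PosSemidef) {w : m → ℂ}
    (hw : expect A w = c * (star w ⬝ᵥ w).re) : A *ᵥ w = (c : ℂ) • w := by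
  have h0 := (h.dotProduct_mulVec_zero_iff w).1 (Complex.ext (by
    change expect _ w = 0
    rw [expect_sub_smul_one, hw, sub_self])
    (Complex.nonneg_iff.1 (h.dotProduct_mulVec_nonneg w)).2.symm)
  rwa [sub_mulVec, smul_mulVec, one_mulVec, sub_eq_zero] at h0

end Spectral

section Pauli

open scoped ComplexOrder

variable {n : ℕ}

lemma tens_mul (P Q : Fin n → Matrix (Fin 2) (Fin 2) ℂ) :
    tens P * tens Q = tens fun i => P i * Q i := by
  ext v w
  simp only [tens, mul_apply, of_apply, Fintype.prod_sum, Finset.prod_mul_distrib]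

lemma tens_one : tens (fun _ : Fin n => (1 : Matrix (Fin 2) (Fin 2) ℂ)) = 1 := by
  ext v w
  simp only [tens, of_apply, one_apply, Finset.prod_ite_zero, Finset.prod_const_one,
    funext_iff, Finset.mem_univ, true_implies]

lemma trace_tens (P : Fin n → Matrix (Fin 2) (Fin 2) ℂ) :
    (tens P).trace = ∏ i, (P i).trace := by
  simp only [trace, diag_apply, tens, of_apply, Fintype.prod_sum]

lemma tens_isHermitian {P : Fin n → Matrix (Fin 2) (Fin 2) ℂ} (h : ∀ i, (P i).IsHermitian) :
    (tens P).IsHermitian := by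
  ext v w
  simp only [conjTranspose_apply, tens, of_apply, star_prod, (h _).apply]

/-- One of the single-qubit matrices `I`, `X`, `Y`, `Z`. -/
def IsPauliMatrix (Q : Matrix (Fin 2) (Fin 2) ℂ) : Prop := Q = 1 ∨ Q = PX ∨ Q = PY ∨ Q = PZ

lemma IsPauliMatrix.isHermitian {Q : Matrix (Fin 2) (Fin 2) ℂ} (h : IsPauliMatrix Q) :
    Q.IsHermitian := by
  rcases h with rfl | rfl | rfl | rfl <;> ext i j <;> fin_cases i <;> fin_cases j <;>
    simp [PX, PY, PZ]

lemma IsPauliMatrix.mul_self {Q : Matrix (Fin 2) (Fin 2) ℂ} (h : IsPauliMatrix Q) :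
    Q * Q = 1 := by
  rcases h with rfl | rfl | rfl | rfl <;> ext i j <;> fin_cases i <;> fin_cases j <;>
    simp [PX, PY, PZ]

lemma IsPauliMatrix.eq_one_or_trace_eq_zero {Q : Matrix (Fin 2) (Fin 2) ℂ}
    (h : IsPauliMatrix Q) : Q = 1 ∨ Q.trace = 0 := by
  rcases h with rfl | rfl | rfl | rfl <;> simp [PX, PY, PZ, trace_fin_two]

variable (n) in
lemma finite_isPauli : {A : QOp n | IsPauli A}.Finite := by
  have h1 : ({1, -1, Complex.I, -Complex.I} : Set ℂ).Finite := Set.toFinite _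
  have h2 : {P : Fin n → Matrix (Fin 2) (Fin 2) ℂ |
      ∀ i, P i ∈ ({1, PX, PY, PZ} : Set (Matrix (Fin 2) (Fin 2) ℂ))}.Finite :=
    Set.Finite.pi' fun _ => Set.toFinite _
  refine (h1.image2 (fun c P => c • tens P) h2).subset ?_
  rintro A ⟨c, hc, P, hP, rfl⟩
  exact ⟨c, hc, P, hP, rfl⟩

variable {S : Set (QOp n)}

/-- Elements of a stabilizer group carry a real sign. -/
lemma IsStabGroup.exists_sign (hS : IsStabGroup S) {A : QOp n} (hA : A ∈ S) :
    ∃ c : ℂ, (c = 1 ∨ c = -1) ∧ ∃ P : Fin n → Matrix (Fin 2) (Fin 2) ℂ,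
      (∀ i, IsPauliMatrix (P i)) ∧ A = c • tens P := by
  obtain ⟨c, hc, P, hP, rfl⟩ := hS.pauli A hA
  have hsq : tens P * tens P = 1 := by
    rw [tens_mul, ← tens_one]
    exact congrArg tens (funext fun i => IsPauliMatrix.mul_self (hP i))
  have hmem := hS.mul_mem _ hA _ hA
  rw [smul_mul_smul_comm, hsq] at hmem
  refine ⟨c, ?_, P, hP, rfl⟩
  rcases hc with rfl | rfl | rfl | rfl
  · exact Or.inl rfl
  · exact Or.inr rfl
  all_goals
    refine absurd ?_ hS.neg_one_not_mem
    simpa using hmem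

lemma IsStabGroup.isHermitian (hS : IsStabGroup S) {A : QOp n} (hA : A ∈ S) :
    A.IsHermitian := by
  obtain ⟨c, hc, P, hP, rfl⟩ := hS.exists_sign hA
  have := tens_isHermitian fun i => (hP i).isHermitian
  rcases hc with rfl | rfl <;> simpa using this

lemma IsStabGroup.mul_self (hS : IsStabGroup S) {A : QOp n} (hA : A ∈ S) : A * A = 1 := by
  obtain ⟨c, hc, P, hP, rfl⟩ := hS.exists_sign hA
  have hsq : tens P * tens P = 1 := by
    rw [tens_mul, ← tens_one]
    exact congrArg tens (funext fun i => (hP i).mul_self)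
  rcases hc with rfl | rfl <;> simp [hsq]

lemma IsStabGroup.trace_eq_zero (hS : IsStabGroup S) {A : QOp n} (hA : A ∈ S) (h1 : A ≠ 1) :
    A.trace = 0 := by
  obtain ⟨c, hc, P, hP, rfl⟩ := hS.exists_sign hA
  by_cases hall : ∀ i, P i = 1
  · obtain rfl : P = fun _ => 1 := funext hall
    rw [tens_one] at hA h1
    rcases hc with rfl | rfl
    · simp at h1
    · exact absurd (by simpa using hA) hS.neg_one_not_mem
  · push Not at hall
    obtain ⟨i, hi⟩ := hall
    rw [trace_smul, trace_tens, Finset.prod_eq_zero (Finset.mem_univ i)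
      ((hP i).eq_one_or_trace_eq_zero.resolve_left hi), smul_zero]

lemma proj_mulVec (ψ w : QVec n) : proj ψ *ᵥ w = (star ψ ⬝ᵥ w) • ψ := by
  rw [proj, vecMulVec_mulVec]
  ext i
  simp [mul_comm]

lemma proj_isHermitian (ψ : QVec n) : (proj ψ).IsHermitian := by
  simp [IsHermitian, proj, conjTranspose_vecMulVec]

/-- A stabilizer state's projector is the average of its stabilizer group. -/
lemma proj_eq_average (hS : IsMaxStabGroup S) {ψ : QVec n} (hψ : star ψ ⬝ᵥ ψ = 1)
    (hfix : ∀ A ∈ S, A *ᵥ ψ = ψ) : proj ψ = ((2 : ℂ) ^ n)⁻¹ • ∑ᶠ g ∈ S, g := by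
  obtain ⟨hS, hcard⟩ := hS
  have hfin : S.Finite := by
    have : Finite S := Nat.finite_of_card_ne_zero (by rw [hcard]; positivity)
    exact S.toFinite
  rw [finsum_mem_eq_finite_toFinset_sum _ hfin]
  set T := hfin.toFinset with hT
  have memT : ∀ {g}, g ∈ T ↔ g ∈ S := by simp [hT]
  have hTcard : (T.card : ℂ) = 2 ^ n := by
    rw [hT, ← Set.ncard_eq_toFinset_card S hfin, ← Nat.card_coe_set_eq, hcard]
    push_cast
    rfl
  have h2 : (2 : ℂ) ^ n ≠ 0 := by positivity
  set R : QOp n := ((2 : ℂ) ^ n)⁻¹ • ∑ g ∈ T, g with hR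
  have hmul : ∀ g ∈ T, g * ∑ h ∈ T, h = ∑ h ∈ T, h := by
    intro g hg
    have hgg := hS.mul_self (memT.1 hg)
    rw [Finset.mul_sum]
    refine Finset.sum_nbij' (fun h => g * h) (fun h => g * h) ?_ ?_ ?_ ?_ ?_
    · exact fun h hh => memT.2 (hS.mul_mem _ (memT.1 hg) _ (memT.1 hh))
    · exact fun h hh => memT.2 (hS.mul_mem _ (memT.1 hg) _ (memT.1 hh))
    · intro h _
      rw [← mul_assoc, hgg, one_mul]
    · intro h _
      rw [← mul_assoc, hgg, one_mul]
    · exact fun _ _ => rfl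
  have hRR : R * R = R := by
    rw [hR, smul_mul_smul_comm, Finset.sum_mul, Finset.sum_congr rfl hmul, Finset.sum_const,
      ← Nat.cast_smul_eq_nsmul ℂ, hTcard, smul_smul, mul_assoc, inv_mul_cancel₀ h2, mul_one]
  have hRψ : R *ᵥ ψ = ψ := by
    rw [hR, smul_mulVec, sum_mulVec, Finset.sum_congr rfl fun g hg => hfix g (memT.1 hg),
      Finset.sum_const, ← Nat.cast_smul_eq_nsmul ℂ, hTcard, smul_smul, inv_mul_cancel₀ h2,
      one_smul]
  have hRherm : R.IsHermitian := by
    have : (∑ g ∈ T, g)ᴴ = ∑ g ∈ T, g := by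
      rw [conjTranspose_sum]
      exact Finset.sum_congr rfl fun g hg => hS.isHermitian (memT.1 hg)
    rw [IsHermitian, hR, conjTranspose_smul, this]
    simp
  have hRtr : R.trace = 1 := by
    rw [hR, trace_smul, trace_sum, Finset.sum_eq_single 1
      (fun g hg h1 => hS.trace_eq_zero (memT.1 hg) h1) (fun h => absurd (memT.2 hS.one_mem) h),
      trace_one]
    simp [h2]
  have hRp : R * proj ψ = proj ψ := by
    rw [proj, mul_vecMulVec, hRψ]
  have hpR : proj ψ * R = proj ψ := by
    have := congrArg conjTranspose hRp
    rwa [conjTranspose_mul, hRherm, proj_isHermitian] at this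
  have hpp : proj ψ * proj ψ = proj ψ := by
    rw [proj, vecMulVec_mul_vecMulVec, hψ]
    simp
  have hDherm : (R - proj ψ)ᴴ = R - proj ψ := by
    rw [conjTranspose_sub, hRherm, proj_isHermitian]
  have hD : (R - proj ψ) * (R - proj ψ) = R - proj ψ := by
    rw [sub_mul, mul_sub, mul_sub, hRR, hRp, hpR, hpp, sub_self, sub_zero]
  have h0 : R - proj ψ = 0 := by
    rw [← trace_conjTranspose_mul_self_eq_zero_iff, hDherm, hD, trace_sub, hRtr, proj,
      trace_vecMulVec, dotProduct_comm, hψ, sub_self]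
  exact (sub_eq_zero.1 h0).symm

variable (n) in
/-- There are only finitely many projectors onto pure stabilizer states. -/
lemma finite_stabProj : {M : QOp n | ∃ ψ : QVec n, IsPureStab ψ ∧ M = proj ψ}.Finite := by
  refine ((finite_isPauli n).finite_subsets.image
    fun S : Set (QOp n) => ((2 : ℂ) ^ n)⁻¹ • ∑ᶠ g ∈ S, g).subset ?_
  rintro _ ⟨ψ, ⟨hψ, S, hS, hfix⟩, rfl⟩
  exact ⟨S, hS.1.pauli, (proj_eq_average hS hψ hfix).symm⟩

end Pauli

section Perturbation

open scoped ComplexOrder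

variable {n : ℕ}

lemma trace_mul_proj_re (H : QOp n) (ψ : QVec n) :
    ((H * proj ψ).trace).re = expect H ψ := by
  rw [proj, mul_vecMulVec, trace_vecMulVec, dotProduct_comm, expect]

lemma expect_eq_of_proj_eq {ψ χ : QVec n} (h : proj ψ = proj χ) (H : QOp n) :
    expect H ψ = expect H χ := by
  rw [← trace_mul_proj_re, h, trace_mul_proj_re]

lemma proj_eq_of_eq_smul {ψ χ : QVec n} (hψ : star ψ ⬝ᵥ ψ = 1) (hχ : star χ ⬝ᵥ χ = 1)
    {c : ℂ} (h : χ = c • ψ) : proj χ = proj ψ := by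
  subst h
  have hc : c * star c = 1 := by
    rw [star_smul, smul_dotProduct, dotProduct_smul, hψ] at hχ
    simpa [mul_comm] using hχ
  rw [proj, proj, star_smul, smul_vecMulVec, vecMulVec_smul, smul_smul, hc, one_smul]

/-- The stabilizer gap is positive as soon as no pure stabilizer state reaches the ground
energy. -/
lemma stabGap_pos {H : QOp n} (hne : ∃ χ : QVec n, IsPureStab χ)
    (h : ∀ χ : QVec n, IsPureStab χ → minEig H < expect H χ) : 0 < stabGap H := by
  obtain ⟨χ₀, hχ₀⟩ := hne
  obtain ⟨_, ⟨χ, hχ, rfl⟩, hmin⟩ := Set.exists_min_image _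
    (fun ρ : QOp n => ((H * ρ).trace).re) (finite_stabProj n) ⟨_, χ₀, hχ₀, rfl⟩
  have hlin : IsLinearMap ℝ fun ρ : QOp n => ((H * ρ).trace).re :=
    ⟨fun x y => by simp [mul_add], fun c x => by simp⟩
  have hsub : StabPolytope n ⊆
      {ρ : QOp n | ((H * proj χ).trace).re ≤ ((H * ρ).trace).re} :=
    convexHull_min hmin (convex_halfSpace_ge hlin _)
  have hle : ((H * proj χ).trace).re ≤ stabEnergy H := by
    refine le_csInf (Set.Nonempty.image _ ⟨_, subset_convexHull ℝ _ ⟨χ₀, hχ₀, rfl⟩⟩) ?_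
    rintro _ ⟨ρ, hρ, rfl⟩
    exact hsub hρ
  rw [trace_mul_proj_re] at hle
  have := h χ hχ
  rw [stabGap]
  linarith

/-- Vectors orthogonal to a nondegenerate ground state have energy above the gap. -/
lemma le_expect_of_orthogonal {H₀ : QOp n} (hH₀ : H₀.IsHermitian) {ψS : QVec n} {Δ : ℝ}
    (hunit : star ψS ⬝ᵥ ψS = 1)
    (hground : H₀ *ᵥ ψS = (minEig H₀ : ℂ) • ψS)
    (huniq : ∀ φ : QVec n, φ ≠ 0 → H₀ *ᵥ φ = (minEig H₀ : ℂ) • φ → ∃ c : ℂ, φ = c • ψS)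
    (hgap : ∀ E : ℝ, (∃ φ : QVec n, φ ≠ 0 ∧ H₀ *ᵥ φ = (E : ℂ) • φ) →
      E = minEig H₀ ∨ minEig H₀ + Δ ≤ E)
    {w : QVec n} (hw : star ψS ⬝ᵥ w = 0) :
    (minEig H₀ + Δ) * (star w ⬝ᵥ w).re ≤ expect H₀ w := by
  have hA : (H₀ + Δ • proj ψS).IsHermitian := by
    refine hH₀.add ?_
    rw [IsHermitian, conjTranspose_smul, proj_isHermitian, star_trivial]
  have happ : ∀ φ : QVec n,
      (H₀ + Δ • proj ψS) *ᵥ φ = H₀ *ᵥ φ + ((Δ : ℂ) * (star ψS ⬝ᵥ φ)) • ψS := fun φ => by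
    rw [add_mulVec, smul_mulVec, proj_mulVec, mul_smul]
    rfl
  have hleft : ∀ φ : QVec n, star ψS ⬝ᵥ H₀ *ᵥ φ = (minEig H₀ : ℂ) * (star ψS ⬝ᵥ φ) := fun φ => by
    have : star ψS ᵥ* H₀ = (minEig H₀ : ℂ) • star ψS := by
      have h := congrArg star hground
      rw [star_mulVec, hH₀, star_smul] at h
      simpa using h
    rw [dotProduct_mulVec, this, smul_dotProduct, smul_eq_mul]
  have hpsd := posSemidef_sub_of_le (c := minEig H₀ + Δ) hA fun E φ hφ hE => by
    rw [happ] at hE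
    by_cases h0 : star ψS ⬝ᵥ φ = 0
    · rw [h0, mul_zero, zero_smul, add_zero] at hE
      rcases hgap E ⟨φ, hφ, hE⟩ with rfl | h
      · obtain ⟨c, rfl⟩ := huniq φ hφ hE
        rw [dotProduct_smul, hunit, smul_eq_mul, mul_one] at h0
        simp [h0] at hφ
      · exact h
    · have h1 := congrArg (fun v => star ψS ⬝ᵥ v) hE
      simp only [dotProduct_add, dotProduct_smul, hleft, hunit, smul_eq_mul, mul_one] at h1
      rw [← add_mul] at h1
      have h2 := mul_right_cancel₀ h0 h1
      exact le_of_eq (by exact_mod_cast h2)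
  have hle := le_expect hpsd w
  rwa [expect, happ, hw, mul_zero, zero_smul, add_zero] at hle

/-- If all vectors orthogonal to `ψS` have energy above the ground energy, the ground state
is unique. -/
lemma ground_unique {H : QOp n} {ψS : QVec n}
    (h : ∀ w : QVec n, star ψS ⬝ᵥ w = 0 → w ≠ 0 →
      minEig H * (star w ⬝ᵥ w).re < expect H w)
    {φ ψ : QVec n} (hφ : star φ ⬝ᵥ φ = 1) (hψ : star ψ ⬝ᵥ ψ = 1)
    (hφE : H *ᵥ φ = (minEig H : ℂ) • φ) (hψE : H *ᵥ ψ = (minEig H : ℂ) • ψ) :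
    proj φ = proj ψ := by
  have hzero : ∀ w : QVec n, star ψS ⬝ᵥ w = 0 → H *ᵥ w = (minEig H : ℂ) • w → w = 0 := by
    intro w hw hE
    by_contra hne
    exact (h w hw hne).ne (expect_eq_of_eigen hE).symm
  have hb : star ψS ⬝ᵥ ψ ≠ 0 := fun hb => ne_zero_of_unit hψ (hzero ψ hb hψE)
  have hw := hzero ((star ψS ⬝ᵥ ψ) • φ - (star ψS ⬝ᵥ φ) • ψ)
    (by rw [dotProduct_sub, dotProduct_smul, dotProduct_smul, smul_eq_mul, smul_eq_mul,
          mul_comm, sub_self])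
    (by rw [mulVec_sub, mulVec_smul, mulVec_smul, hφE, hψE, smul_sub, smul_comm,
          smul_comm (star ψS ⬝ᵥ φ)])
  refine proj_eq_of_eq_smul (c := (star ψS ⬝ᵥ ψ)⁻¹ * (star ψS ⬝ᵥ φ)) hψ hφ ?_
  rw [mul_smul, ← sub_eq_zero.1 hw, smul_smul, inv_mul_cancel₀ hb, one_smul]

end Perturbation

/-- a generic perturbation of a stabilizer Hamiltonian with unique
stabilizer ground state creates a positive stabilizer gap. -/
theorem perturbation_creates_stabilizer_gap {n : ℕ} (G : Finset (QOp n))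
    (H₀ V : QOp n) (ψS : QVec n) (Δ : ℝ)
    (hmax : IsMaxStabGroup
      ((Submonoid.closure (G : Set (QOp n)) : Submonoid (QOp n)) : Set (QOp n)))
    (hindep : ∀ g ∈ G, g ∉ Submonoid.closure ((G : Set (QOp n)) \ {g}))
    (hH₀ : H₀ = -∑ g ∈ G, g)
    (hψS : IsPureStab ψS)
    (hground : H₀.mulVec ψS = (minEig H₀ : ℂ) • ψS)
    (huniq : ∀ φ : QVec n, φ ≠ 0 → H₀.mulVec φ = (minEig H₀ : ℂ) • φ →
      ∃ c : ℂ, φ = c • ψS)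
    (hΔpos : 0 < Δ)
    (hgap : ∀ E : ℝ, (∃ φ : QVec n, φ ≠ 0 ∧ H₀.mulVec φ = (E : ℂ) • φ) →
      E = minEig H₀ ∨ minEig H₀ + Δ ≤ E)
    (hV : V.IsHermitian)
    (hcouple : V.mulVec ψS - (star ψS ⬝ᵥ V.mulVec ψS) • ψS ≠ 0) :
    ∃ lam₀ : ℝ, 0 < lam₀ ∧ ∀ lam : ℝ, 0 < |lam| → |lam| < lam₀ →
      (∃ ψ : QVec n, star ψ ⬝ᵥ ψ = 1 ∧
        (H₀ + lam • V).mulVec ψ = (minEig (H₀ + lam • V) : ℂ) • ψ ∧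
        (∀ φ : QVec n, star φ ⬝ᵥ φ = 1 →
          (H₀ + lam • V).mulVec φ = (minEig (H₀ + lam • V) : ℂ) • φ →
          proj φ = proj ψ) ∧
        (∀ χ : QVec n, IsPureStab χ → proj ψ ≠ proj χ)) ∧
      0 < stabGap (H₀ + lam • V) := by
  have hH₀h : H₀.IsHermitian := by
    rw [hH₀, IsHermitian, conjTranspose_neg, conjTranspose_sum]
    exact congrArg _ (Finset.sum_congr rfl fun g hg =>
      hmax.1.isHermitian (Submonoid.subset_closure hg))
  have hunit := hψS.1
  have hψ0 := ne_zero_of_unit hunit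
  have hHh : ∀ lam : ℝ, (H₀ + lam • V).IsHermitian := fun lam => by
    refine hH₀h.add ?_
    rw [IsHermitian, conjTranspose_smul, hV, star_trivial]
  have hexp : ∀ (lam : ℝ) (w : QVec n),
      expect (H₀ + lam • V) w = expect H₀ w + lam * expect V w := fun lam w => by
    rw [expect_add, expect_smul]
  have hE₀ : expect H₀ ψS = minEig H₀ := by
    rw [expect_eq_of_eigen hground, hunit, Complex.one_re, mul_one]
  set C := ∑ i, ∑ j, ‖V i j‖ with hC
  have hsmall : ∀ᶠ lam : ℝ in nhds 0, |lam| * (2 * C) < Δ := by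
    refine ContinuousAt.eventually_lt (by fun_prop) continuousAt_const ?_
    simpa using hΔpos
  have hstab : ∀ᶠ lam : ℝ in nhds 0,
      ∀ M ∈ {M : QOp n | ∃ χ : QVec n, IsPureStab χ ∧ M = proj χ},
        M ≠ proj ψS →
          ((H₀ + lam • V) * proj ψS).trace.re < ((H₀ + lam • V) * M).trace.re := by
    rw [Filter.eventually_all_finite (finite_stabProj n)]
    rintro _ ⟨χ, hχ, rfl⟩
    rw [Filter.eventually_imp_distrib_left]
    intro hne
    simp only [trace_mul_proj_re, hexp]
    refine ContinuousAt.eventually_lt (by fun_prop) (by fun_prop) ?_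
    have hpsd := posSemidef_sub_minEig hH₀h
    have hle := le_expect hpsd χ
    rw [hχ.1, Complex.one_re, mul_one] at hle
    rw [zero_mul, zero_mul, add_zero, add_zero, hE₀]
    refine lt_of_le_of_ne hle fun heq => hne ?_
    obtain ⟨c, hc⟩ := huniq χ (ne_zero_of_unit hχ.1) (eigen_of_expect_eq hpsd (by
      rw [hχ.1, Complex.one_re, mul_one, heq]))
    exact proj_eq_of_eq_smul hunit hχ.1 hc
  obtain ⟨lam₀, hpos, hball⟩ := Metric.eventually_nhds_iff.1 (hsmall.and hstab)
  refine ⟨lam₀, hpos, fun lam hlam hlt => ?_⟩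
  obtain ⟨hΔlam, hχlam⟩ := hball (y := lam) (by simpa using hlt)
  set H := H₀ + lam • V with hH
  have hpsd := posSemidef_sub_minEig (hHh lam)
  have hSle : minEig H ≤ expect H ψS := by
    simpa [hunit] using le_expect hpsd ψS
  have hSlt : minEig H < expect H ψS := by
    refine lt_of_le_of_ne hSle fun heq => hcouple ?_
    have heig : H *ᵥ ψS = (minEig H : ℂ) • ψS :=
      eigen_of_expect_eq hpsd (by rw [hunit, Complex.one_re, mul_one, heq])
    have hlam0 : (lam : ℂ) ≠ 0 := by exact_mod_cast abs_pos.1 hlam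
    have hVS : V *ᵥ ψS = ((lam : ℂ)⁻¹ * (minEig H - minEig H₀)) • ψS := by
      rw [hH, add_mulVec, smul_mulVec, hground, ← hH] at heig
      have h1 : (lam : ℂ) • V *ᵥ ψS = ((minEig H : ℂ) - minEig H₀) • ψS := by
        rw [sub_smul, ← heig, add_sub_cancel_left]
        rfl
      rw [mul_smul, ← h1, smul_smul, inv_mul_cancel₀ hlam0, one_smul]
    rw [hVS, dotProduct_smul, hunit, smul_eq_mul, mul_one, sub_self]
  have hstablt : ∀ χ : QVec n, IsPureStab χ → minEig H < expect H χ := by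
    intro χ hχ
    by_cases hp : proj χ = proj ψS
    · rwa [expect_eq_of_proj_eq hp]
    · have := hχlam _ ⟨χ, hχ, rfl⟩ hp
      rw [trace_mul_proj_re, trace_mul_proj_re] at this
      exact hSlt.trans this
  have horth : ∀ w : QVec n, star ψS ⬝ᵥ w = 0 → w ≠ 0 →
      minEig H * (star w ⬝ᵥ w).re < expect H w := by
    intro w hw hw0
    have hN := star_dotProduct_self_re_pos hw0
    have h1 := le_expect_of_orthogonal hH₀h hunit hground huniq hgap hw
    have h2 : |lam * expect V w| ≤ |lam| * (C * (star w ⬝ᵥ w).re) := by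
      rw [abs_mul]
      exact mul_le_mul_of_nonneg_left (abs_expect_le V w) (abs_nonneg _)
    have h3 : |lam * expect V ψS| ≤ |lam| * C := by
      rw [abs_mul]
      have := abs_expect_le V ψS
      rw [hunit, Complex.one_re, mul_one] at this
      exact mul_le_mul_of_nonneg_left this (abs_nonneg _)
    have h4 := hexp lam ψS
    rw [← hH, hE₀] at h4
    have h5 : minEig H < minEig H₀ + Δ - |lam| * C := by
      linarith [(abs_le.1 h3).2]
    have h6 := mul_lt_mul_of_pos_right h5 hN
    rw [hH, hexp]
    linarith [(abs_le.1 h2).1]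
  refine ⟨?_, stabGap_pos ⟨ψS, hψS⟩ hstablt⟩
  obtain ⟨ψ₀, hψ₀, hψ₀E⟩ := (isLeast_minEig (hHh lam)).1
  obtain ⟨c, hc⟩ := exists_unit_smul hψ₀
  have hcE : H *ᵥ (c • ψ₀) = (minEig H : ℂ) • c • ψ₀ := by
    rw [mulVec_smul, hψ₀E, smul_comm]
  refine ⟨c • ψ₀, hc, hcE, fun φ hφ hφE => ground_unique horth hφ hc hφE hcE, ?_⟩
  intro χ hχ heq
  refine (hstablt χ hχ).ne ?_
  rw [← expect_eq_of_proj_eq heq, expect_eq_of_eigen hcE, hc, Complex.one_re, mul_one]
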